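/- arXiv:2311.05062 — 4 statements merged into one kernel-verified Lean document; each statement's English description precedes it below -/
import Mathlib

section
/- Let a, a', a₊, a₊', A₀₀, A₀₁, B₀₀, B₀₁, B₀₂, B₀₃ and w be real numbers, and let B be the 4×4 real matrix B = [[−B₀₀·w², B₀₁·w², a₊'−B₀₂·w², a₊+B₀₃·w²],[−B₀₁·w², 2·B₀₂·w², a₊−3·B₀₃·w², 0],[−a'−B₀₂·w², a+B₀₃·w², A₀₀, −A₀₁],[a−B₀₃·w², 0, A₀₁, 0]]. If one of the following three conditions holds: (a) A₀₀ = A₀₁ = 0 and B₀₃ = 0; (b) A₀₁ = 0 and B₀₂ = B₀₃ = 0; (c) B₀₁ = B₀₂ = B₀₃ = 0; then det B = a₊²·a². -/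
/-- Under any of the conditions (a) `A₀₀ = A₀₁ = 0` and `B₀₃ = 0`, (b) `A₀₁ = 0` and
`B₀₂ = B₀₃ = 0`, (c) `B₀₁ = B₀₂ = B₀₃ = 0`, the determinant of the interface matrix `B`
equals `a₊² a²`.  Here `aP` stands for `a₊` and `aP'` for `a₊'`. -/
theorem stmt_6 (a a' aP aP' A₀₀ A₀₁ B₀₀ B₀₁ B₀₂ B₀₃ w : ℝ)
    (h : (A₀₀ = 0 ∧ A₀₁ = 0 ∧ B₀₃ = 0) ∨
         (A₀₁ = 0 ∧ B₀₂ = 0 ∧ B₀₃ = 0) ∨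
         (B₀₁ = 0 ∧ B₀₂ = 0 ∧ B₀₃ = 0)) :
    Matrix.det !![-(B₀₀ * w ^ 2), B₀₁ * w ^ 2, aP' - B₀₂ * w ^ 2, aP + B₀₃ * w ^ 2;
                  -(B₀₁ * w ^ 2), 2 * B₀₂ * w ^ 2, aP - 3 * B₀₃ * w ^ 2, 0;
                  -a' - B₀₂ * w ^ 2, a + B₀₃ * w ^ 2, A₀₀, -A₀₁;
                  a - B₀₃ * w ^ 2, 0, A₀₁, 0] = aP ^ 2 * a ^ 2 := by
  rcases h with ⟨rfl, rfl, rfl⟩ | ⟨rfl, rfl, rfl⟩ | ⟨rfl, rfl, rfl⟩ <;>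
  · simp [Matrix.det_succ_row_zero, Fin.sum_univ_succ, Fin.succAbove]
    try ring
end

section
/- Let a, a', a₋, a₋', A₁₀, A₁₁, B₁₀, B₁₁, B₁₂, B₁₃ and w be real numbers, and let A be the 4×4 real matrix A = [[B₁₀·w², −B₁₁·w², a₋'+B₁₂·w², a₋−B₁₃·w²],[B₁₁·w², −2·B₁₂·w², a₋+3·B₁₃·w², 0],[−a'+B₁₂·w², a−3·B₁₃·w², −A₁₀, A₁₁],[a+B₁₃·w², 0, −A₁₁, 0]]. If one of the following three conditions holds: (a) A₁₀ = A₁₁ = 0 and B₁₃ = 0; (b) A₁₁ = 0 and B₁₂ = B₁₃ = 0; (c) B₁₁ = B₁₂ = B₁₃ = 0; then det A = a₋²·a². -/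
/-- Under any of the conditions (a) `A₁₀ = A₁₁ = 0` and `B₁₃ = 0`, (b) `A₁₁ = 0` and
`B₁₂ = B₁₃ = 0`, (c) `B₁₁ = B₁₂ = B₁₃ = 0`, the determinant of the interface matrix `A`
equals `a₋² a²`.  Here `aM` stands for `a₋` and `aM'` for `a₋'`. -/
theorem stmt_7 (a a' aM aM' A₁₀ A₁₁ B₁₀ B₁₁ B₁₂ B₁₃ w : ℝ)
    (h : (A₁₀ = 0 ∧ A₁₁ = 0 ∧ B₁₃ = 0) ∨
         (A₁₁ = 0 ∧ B₁₂ = 0 ∧ B₁₃ = 0) ∨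
         (B₁₁ = 0 ∧ B₁₂ = 0 ∧ B₁₃ = 0)) :
    Matrix.det !![B₁₀ * w ^ 2, -(B₁₁ * w ^ 2), aM' + B₁₂ * w ^ 2, aM - B₁₃ * w ^ 2;
                  B₁₁ * w ^ 2, -(2 * B₁₂ * w ^ 2), aM + 3 * B₁₃ * w ^ 2, 0;
                  -a' + B₁₂ * w ^ 2, a - 3 * B₁₃ * w ^ 2, -A₁₀, A₁₁;
                  a + B₁₃ * w ^ 2, 0, -A₁₁, 0] = aM ^ 2 * a ^ 2 := by
  rcases h with ⟨h1, h2, h3⟩ | ⟨h1, h2, h3⟩ | ⟨h1, h2, h3⟩ <;> subst h1 h2 h3 <;>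
    simp [Matrix.det_succ_row_zero, Fin.sum_univ_succ, Fin.succAbove] <;> ring
end

section
/- Let a, a', a₋, a₋', a₊, a₊', w, B₀₀, B₀₁, B₁₀, B₁₁ be real numbers with a ≠ 0, and let A and B be the 4×4 matrices A = [[B₁₀·w², −B₁₁·w², a₋', a₋],[B₁₁·w², 0, a₋, 0],[−a', a, 0, 0],[a, 0, 0, 0]] and B = [[−B₀₀·w², B₀₁·w², a₊', a₊],[−B₀₁·w², 0, a₊, 0],[−a', a, 0, 0],[a, 0, 0, 0]] (i.e. the general interface matrices with all Aᵢⱼ = 0 and Bᵢ₂ = Bᵢ₃ = 0 for i = 0,1). Let ξ₀ ∈ ℝ and let φ₁, φ₂ : ℝ → ℝ be continuously differentiable functions whose boundary-value vectors v₁ = (φ₁(ξ₀), φ₁'(ξ₀), φ₁''(ξ₀), φ₁'''(ξ₀)) and v₂ = (φ₂(ξ₀), φ₂'(ξ₀), φ₂''(ξ₀), φ₂'''(ξ₀)) satisfy A·v₁ = B·v₂. Then φ₁(ξ₀) = φ₂(ξ₀) and φ₁'(ξ₀) = φ₂'(ξ₀), and consequently the piecewise function φ : ℝ → ℝ defined by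 φ(x) = φ₁(x) for x ≤ ξ₀ and φ(x) = φ₂(x) for x > ξ₀ is continuously differentiable on ℝ. -/
/-- If `a ≠ 0`, all `Aᵢⱼ = 0` and `Bᵢ₂ = Bᵢ₃ = 0` (already substituted in the interface
matrices), and the boundary-value vectors of continuously differentiable `φ₁, φ₂` at the
singular point `ξ₀` satisfy `A·v₁ = B·v₂`, then `φ₁ ξ₀ = φ₂ ξ₀`, `φ₁' ξ₀ = φ₂' ξ₀`, and
the piecewise-glued function is continuously differentiable.
Here `aM, aM', aP, aP'` stand for `a₋, a₋', a₊, a₊'`. -/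
theorem stmt_9 (a a' aM aM' aP aP' w B₀₀ B₀₁ B₁₀ B₁₁ : ℝ)
    (ha : a ≠ 0) (ξ₀ : ℝ) (φ₁ φ₂ : ℝ → ℝ)
    (hc1 : ContDiff ℝ 1 φ₁) (hc2 : ContDiff ℝ 1 φ₂)
    (hmatch :
      Matrix.mulVec !![B₁₀ * w ^ 2, -(B₁₁ * w ^ 2), aM', aM;
                       B₁₁ * w ^ 2, 0, aM, 0;
                       -a', a, 0, 0;
                       a, 0, 0, 0]
        ![φ₁ ξ₀, deriv φ₁ ξ₀, deriv^[2] φ₁ ξ₀, deriv^[3] φ₁ ξ₀] =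
      Matrix.mulVec !![-(B₀₀ * w ^ 2), B₀₁ * w ^ 2, aP', aP;
                       -(B₀₁ * w ^ 2), 0, aP, 0;
                       -a', a, 0, 0;
                       a, 0, 0, 0]
        ![φ₂ ξ₀, deriv φ₂ ξ₀, deriv^[2] φ₂ ξ₀, deriv^[3] φ₂ ξ₀]) :
    φ₁ ξ₀ = φ₂ ξ₀ ∧ deriv φ₁ ξ₀ = deriv φ₂ ξ₀ ∧
      ContDiff ℝ 1 (fun x : ℝ => if x ≤ ξ₀ then φ₁ x else φ₂ x) := by
  have h3 := congrFun hmatch 3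
  have h2 := congrFun hmatch 2
  simp [Matrix.mulVec, dotProduct, Fin.sum_univ_four] at h3 h2
  have e0 : φ₁ ξ₀ = φ₂ ξ₀ := by
    rcases h3 with h | h
    · exact h
    · exact absurd h ha
  have e1 : deriv φ₁ ξ₀ = deriv φ₂ ξ₀ := by
    rw [e0] at h2
    exact mul_left_cancel₀ ha (by linarith)
  refine ⟨e0, e1, ?_⟩
  have d1 : ∀ x, HasDerivAt φ₁ (deriv φ₁ x) x := fun x =>
    (hc1.differentiable (by norm_num) x).hasDerivAt
  have d2 : ∀ x, HasDerivAt φ₂ (deriv φ₂ x) x := fun x =>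
    (hc2.differentiable (by norm_num) x).hasDerivAt
  have key : ∀ x, HasDerivAt (fun x : ℝ => if x ≤ ξ₀ then φ₁ x else φ₂ x)
      (if x ≤ ξ₀ then deriv φ₁ x else deriv φ₂ x) x := by
    intro x
    rcases lt_trichotomy x ξ₀ with h | h | h
    · rw [if_pos h.le]
      refine (d1 x).congr_of_eventuallyEq ?_
      filter_upwards [Iio_mem_nhds h] with y hy
      exact if_pos (le_of_lt hy)
    · subst h
      rw [if_pos le_rfl, ← hasDerivWithinAt_univ, ← Set.Iic_union_Ici (a := x)]
      refine HasDerivWithinAt.union ?_ ?_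
      · refine (d1 x).hasDerivWithinAt.congr (fun y hy => if_pos hy) (if_pos le_rfl)
      · rw [e1]
        refine (d2 x).hasDerivWithinAt.congr (fun y hy => ?_) ?_
        · rcases eq_or_lt_of_le (Set.mem_Ici.1 hy) with h | h
          · subst h
            simpa using e0
          · exact if_neg (not_le.2 h)
        · simpa using e0
    · rw [if_neg (not_le.2 h)]
      refine (d2 x).congr_of_eventuallyEq ?_
      filter_upwards [Ioi_mem_nhds h] with y hy
      exact if_neg (not_le.2 hy)
  rw [contDiff_one_iff_deriv]
  refine ⟨fun x => (key x).differentiableAt, ?_⟩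
  rw [funext fun x => (key x).deriv]
  refine Continuous.if_le (contDiff_one_iff_deriv.1 hc1).2 (contDiff_one_iff_deriv.1 hc2).2
    continuous_id continuous_const ?_
  intro x hx
  rw [hx, e1]
end

section
/- Let a₀₋, a₀₊, a₁₋, a₁₊, b₀₋, b₀₊, b₁₋, b₁₊ : ℝ → ℝ be infinitely differentiable, let Aᵢⱼ (i,j ∈ {0,1}) and Bᵢⱼ (i ∈ {0,1}, j ∈ {0,1,2,3}) and w be real numbers, and let ξ₀ ∈ ℝ. Set a = a₀₋ + a₁₊, a₋ = a₀₋ + a₁₋, a₊ = a₀₊ + a₁₊, b₋ = b₀₋ + b₁₋, b₊ = b₀₊ + b₁₊. Assume a₋(x) ≠ 0 and a₊(x) ≠ 0 for all x ∈ ℝ, and that the 4×4 matrix B(ξ₀) = [[−B₀₀·w², B₀₁·w², a₊'(ξ₀)−B₀₂·w², a₊(ξ₀)+B₀₃·w²],[−B₀₁·w², 2·B₀₂·w², a₊(ξ₀)−3·B₀₃·w², 0],[−a'(ξ₀)−B₀₂·w², a(ξ₀)+B₀₃·w², A₀₀, −A₀₁],[a(ξ₀)−B₀₃·w², 0, A₀₁,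 0]] has nonzero determinant. Then for every x₀ < ξ₀ and every C = (C₀,C₁,C₂,C₃) ∈ ℝ⁴ there exists a pair of infinitely differentiable functions φ₁, φ₂ : ℝ → ℝ such that: (i) a₋·φ₁⁗ + 2·a₋'·φ₁''' + a₋''·φ₁'' − w²·b₋·φ₁ = 0 on (−∞, ξ₀] and a₊·φ₂⁗ + 2·a₊'·φ₂''' + a₊''·φ₂'' − w²·b₊·φ₂ = 0 on [ξ₀, +∞); (ii) A(ξ₀)·(φ₁(ξ₀),φ₁'(ξ₀),φ₁''(ξ₀),φ₁'''(ξ₀)) = B(ξ₀)·(φ₂(ξ₀),φ₂'(ξ₀),φ₂''(ξ₀),φ₂'''(ξ₀)), where A(ξ₀) = [[B₁₀·w², −B₁₁·w², a₋'(ξ₀)+B₁₂·w², a₋(ξ₀)−B₁₃·w²],[B₁₁·w², −2·B₁₂·w², a₋(ξ₀)+3·B₁₃·w², 0],[−a'(ξ₀)+B₁₂·w², a(ξ₀)−3·B₁₃·w², −A₁₀, A₁₁],[a(ξ₀)+B₁₃·w², 0, −A₁₁, 0]]; (iii) (φ₁(x₀),φ₁'(x₀),φ₁''(x₀),φ₁'''(x₀))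 = C. Moreover, for any two such pairs (φ₁,φ₂) and (ψ₁,ψ₂), one has φ₁ = ψ₁ on (−∞, ξ₀] and φ₂ = ψ₂ on [ξ₀, +∞). -/
open Matrix

/-- `EBPair aM aP bM bP Amat Bmat w ξ₀ x₀ C₀ C₁ C₂ C₃ φ₁ φ₂` says the pair of smooth
functions `(φ₁, φ₂)` solves the left/right classical Euler–Bernoulli eigenvalue ODEs on
`(-∞, ξ₀]` and `[ξ₀, +∞)`, satisfies the interface condition `Amat·v₁ = Bmat·v₂` at `ξ₀`,
and takes the boundary data `C` at `x₀`.  Here `aM, aP, bM, bP` stand for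
`a₋, a₊, b₋, b₊`. -/
def EBPair (aM aP bM bP : ℝ → ℝ) (Amat Bmat : Matrix (Fin 4) (Fin 4) ℝ)
    (w ξ₀ x₀ C₀ C₁ C₂ C₃ : ℝ) (φ₁ φ₂ : ℝ → ℝ) : Prop :=
  ContDiff ℝ (⊤ : ℕ∞) φ₁ ∧ ContDiff ℝ (⊤ : ℕ∞) φ₂ ∧
  (∀ x : ℝ, x ≤ ξ₀ →
    aM x * deriv^[4] φ₁ x + 2 * deriv aM x * deriv^[3] φ₁ x
      + deriv^[2] aM x * deriv^[2] φ₁ x - w ^ 2 * bM x * φ₁ x = 0) ∧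
  (∀ x : ℝ, ξ₀ ≤ x →
    aP x * deriv^[4] φ₂ x + 2 * deriv aP x * deriv^[3] φ₂ x
      + deriv^[2] aP x * deriv^[2] φ₂ x - w ^ 2 * bP x * φ₂ x = 0) ∧
  Amat.mulVec ![φ₁ ξ₀, deriv φ₁ ξ₀, deriv^[2] φ₁ ξ₀, deriv^[3] φ₁ ξ₀] =
    Bmat.mulVec ![φ₂ ξ₀, deriv φ₂ ξ₀, deriv^[2] φ₂ ξ₀, deriv^[3] φ₂ ξ₀] ∧
  φ₁ x₀ = C₀ ∧ deriv φ₁ x₀ = C₁ ∧ deriv^[2] φ₁ x₀ = C₂ ∧ deriv^[3] φ₁ x₀ = C₃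

abbrev EV := Fin 4 → ℝ

def eclamp (R : ℝ) (x : EV) : EV := fun i => max (-R) (min R (x i))

lemma eclamp_lip (R : ℝ) : LipschitzWith 1 (eclamp R) := by
  refine LipschitzWith.of_dist_le_mul fun x y => ?_
  rw [NNReal.coe_one, one_mul]
  refine (dist_pi_le_iff dist_nonneg).2 fun i => ?_
  have h := dist_le_pi_dist x y i
  refine le_trans ?_ h
  simp only [eclamp, Real.dist_eq]
  refine (abs_max_sub_max_le_max _ _ _ _).trans ?_
  simp only [sub_self, abs_zero]
  refine max_le (abs_nonneg _) ((abs_min_sub_min_le_max _ _ _ _).trans ?_)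
  simp

lemma eclamp_norm_le (R : ℝ) (hR : 0 ≤ R) (x : EV) : ‖eclamp R x‖ ≤ R := by
  refine (pi_norm_le_iff_of_nonneg hR).2 fun i => ?_
  simp only [eclamp, Real.norm_eq_abs, abs_le]
  exact ⟨le_max_left _ _, max_le (by linarith) (min_le_left _ _)⟩

lemma eclamp_norm_le' (R : ℝ) (hR : 0 ≤ R) (x : EV) : ‖eclamp R x‖ ≤ ‖x‖ := by
  have h0 : eclamp R 0 = 0 := by
    funext i; simp [eclamp, hR]
  have := (eclamp_lip R).dist_le_mul x 0
  rw [h0] at this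
  simpa [dist_eq_norm] using this

lemma eclamp_eq (R : ℝ) (x : EV) (h : ‖x‖ ≤ R) : eclamp R x = x := by
  funext i
  have := (norm_le_pi_norm x i).trans h
  rw [Real.norm_eq_abs, abs_le] at this
  simp [eclamp, this.1, this.2]

lemma bdd_M (M : ℝ → EV →L[ℝ] EV) (hM : Continuous M) (a b : ℝ) :
    ∃ K : NNReal, ∀ t ∈ Set.Icc a b, ‖M t‖ ≤ K := by
  obtain ⟨C, hC⟩ := (isCompact_Icc (a := a) (b := b)).exists_bound_of_continuousOn hM.continuousOn
  exact ⟨C.toNNReal, fun t ht => (hC t ht).trans (Real.le_coe_toNNReal C)⟩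

lemma lip_M (L : EV →L[ℝ] EV) (K : NNReal) (h : ‖L‖ ≤ K) : LipschitzWith K L :=
  L.lipschitz.weaken h

lemma exists_local (M : ℝ → EV →L[ℝ] EV) (hM : Continuous M) (t₀ T : ℝ) (hT : 0 < T) (c : EV) :
    ∃ α : ℝ → EV, α t₀ = c ∧ ∀ t ∈ Set.Ioo (t₀ - T) (t₀ + T), HasDerivAt α (M t (α t)) t := by
  obtain ⟨K, hK⟩ := bdd_M M hM (t₀ - T) (t₀ + T)
  set R : NNReal := ⟨‖c‖ * Real.exp (K * T), by positivity⟩ with hRdef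
  have hR : (0:ℝ) ≤ R := R.2
  have hPL : IsPicardLindelof (fun t x => M t (eclamp R x)) (tmin := t₀ - T) (tmax := t₀ + T)
      ⟨t₀, by constructor <;> linarith⟩ c (K * R * ⟨T, hT.le⟩) 0 (K * R) K := by
    refine ⟨fun t ht => ?_, fun x _ => ?_, fun t ht x _ => ?_, ?_⟩
    · have := (lip_M (M t) K (hK t ht)).comp (eclamp_lip R)
      rw [mul_one] at this
      exact this.lipschitzOnWith
    · exact (hM.clm_apply continuous_const).continuousOn
    · refine ((M t).le_opNorm _).trans ?_
      rw [NNReal.coe_mul]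
      exact mul_le_mul (hK t ht) (eclamp_norm_le R hR x) (norm_nonneg _) K.2
    · simp only [add_sub_cancel_left, sub_sub_cancel, max_self, NNReal.coe_zero, sub_zero]
      exact le_of_eq rfl
  obtain ⟨α, h0, hα⟩ := hPL.exists_eq_forall_mem_Icc_hasDerivWithinAt₀
  refine ⟨α, h0, ?_⟩
  simp only at h0
  have hd : ∀ t ∈ Set.Ioo (t₀ - T) (t₀ + T), HasDerivAt α (M t (eclamp R (α t))) t := fun t ht =>
    (hα t (Set.Ioo_subset_Icc_self ht)).hasDerivAt (Icc_mem_nhds ht.1 ht.2)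
  have hexp : ∀ s, s ≤ T → gronwallBound ‖c‖ K 0 s ≤ R := by
    intro s hs
    rw [gronwallBound_ε0]
    change _ ≤ ‖c‖ * Real.exp (K * T)
    gcongr
  have hb : ∀ t ∈ Set.Ioo (t₀ - T) (t₀ + T), ‖M t (eclamp R (α t))‖ ≤ K * ‖α t‖ + 0 := by
    intro t ht
    rw [add_zero]
    refine ((M t).le_opNorm _).trans ?_
    exact mul_le_mul (hK t (Set.Ioo_subset_Icc_self ht)) (eclamp_norm_le' R hR _) (norm_nonneg _) K.2
  have hn : ∀ t ∈ Set.Ioo (t₀ - T) (t₀ + T), ‖α t‖ ≤ R := by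
    intro t ht
    rcases le_total t₀ t with h | h
    · have hsub : ∀ s ∈ Set.Icc t₀ t, s ∈ Set.Ioo (t₀ - T) (t₀ + T) := fun s hs =>
        ⟨by linarith [hs.1], by linarith [hs.2, ht.2]⟩
      have := norm_le_gronwallBound_of_norm_deriv_right_le (f := α) (δ := ‖c‖) (K := K) (ε := 0)
        (a := t₀) (b := t)
        (fun s hs => (hd s (hsub s hs)).continuousAt.continuousWithinAt)
        (fun s hs => (hd s (hsub s (Set.Ico_subset_Icc_self hs))).hasDerivWithinAt)
        (by rw [h0]) (fun s hs => hb s (hsub s (Set.Ico_subset_Icc_self hs))) t ⟨h, le_rfl⟩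
      exact this.trans (hexp _ (by linarith [ht.2]))
    · have hsub : ∀ s ∈ Set.Icc (-t₀) (-t), -s ∈ Set.Ioo (t₀ - T) (t₀ + T) := fun s hs =>
        ⟨by linarith [hs.2, ht.1], by linarith [hs.1]⟩
      have hd' : ∀ s ∈ Set.Icc (-t₀) (-t), HasDerivAt (fun s => α (-s))
          (-(M (-s) (eclamp R (α (-s))))) s := fun s hs => by
        have := (hd (-s) (hsub s hs)).scomp s (hasDerivAt_neg s)
        simpa [Function.comp_def] using this
      have := norm_le_gronwallBound_of_norm_deriv_right_le (f := fun s => α (-s)) (δ := ‖c‖)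
        (K := K) (ε := 0) (a := -t₀) (b := -t)
        (fun s hs => (hd' s hs).continuousAt.continuousWithinAt)
        (fun s hs => (hd' s (Set.Ico_subset_Icc_self hs)).hasDerivWithinAt)
        (by simp [h0]) (fun s hs => by
          rw [norm_neg]; exact hb (-s) (hsub s (Set.Ico_subset_Icc_self hs)))
        (-t) ⟨by linarith, le_rfl⟩
      simp only [neg_neg] at this
      exact this.trans (hexp _ (by linarith [ht.1]))
  intro t ht
  have := hd t ht
  rwa [eclamp_eq R _ (hn t ht)] at this

lemma exists_global (M : ℝ → EV →L[ℝ] EV) (hM : Continuous M) (t₀ : ℝ) (c : EV) :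
    ∃ α : ℝ → EV, α t₀ = c ∧ ∀ t, HasDerivAt α (M t (α t)) t := by
  choose α h0 hα using fun n : ℕ => exists_local M hM t₀ (n + 1) (by positivity) c
  have huniq : ∀ m n : ℕ, m ≤ n → ∀ t ∈ Set.Ioo (t₀ - (m + 1)) (t₀ + (m + 1)), α m t = α n t := by
    intro m n hmn
    obtain ⟨K, hK⟩ := bdd_M M hM (t₀ - (m + 1)) (t₀ + (m + 1))
    have hmn' : (m : ℝ) ≤ n := by exact_mod_cast hmn
    exact ODE_solution_unique_of_mem_Ioo (v := fun t x => M t x) (s := fun _ => Set.univ) (K := K)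
      (t₀ := t₀)
      (fun t ht => (lip_M _ K (hK t (Set.Ioo_subset_Icc_self ht))).lipschitzOnWith)
      ⟨by linarith [(Nat.cast_nonneg m : (0:ℝ) ≤ m)], by linarith [(Nat.cast_nonneg m : (0:ℝ) ≤ m)]⟩
      (fun t ht => ⟨hα m t ht, trivial⟩)
      (fun t ht => ⟨hα n t ⟨by linarith [ht.1], by linarith [ht.2]⟩, trivial⟩)
      (by rw [h0, h0])
  have key : ∀ n : ℕ, ∀ t ∈ Set.Ioo (t₀ - (n + 1)) (t₀ + (n + 1)), α ⌈|t - t₀|⌉₊ t = α n t := by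
    intro n t ht
    have h1 := Nat.le_ceil |t - t₀|
    have h2 := abs_le.1 h1
    rcases le_total ⌈|t - t₀|⌉₊ n with h | h
    · exact huniq _ _ h t ⟨by linarith [h2.1], by linarith [h2.2]⟩
    · exact (huniq _ _ h t ht).symm
  refine ⟨fun t => α ⌈|t - t₀|⌉₊ t, by simp [h0], fun t => ?_⟩
  set n := ⌈|t - t₀|⌉₊
  have h2 := abs_le.1 (Nat.le_ceil |t - t₀|)
  have ht : t ∈ Set.Ioo (t₀ - ((n:ℝ) + 1)) (t₀ + (n + 1)) := ⟨by linarith [h2.1], by linarith [h2.2]⟩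
  refine (hα n t ht).congr_of_eventuallyEq ?_
  filter_upwards [Ioo_mem_nhds ht.1 ht.2] with s hs using key n s hs

lemma smooth_sol (M : ℝ → EV →L[ℝ] EV) (hM : ContDiff ℝ (⊤ : ℕ∞) M) (α : ℝ → EV)
    (hα : ∀ t, HasDerivAt α (M t (α t)) t) : ContDiff ℝ (⊤ : ℕ∞) α := by
  have hd : deriv α = fun t => M t (α t) := funext fun t => (hα t).deriv
  have hdiff : Differentiable ℝ α := fun t => (hα t).differentiableAt
  refine contDiff_infty.2 fun n => ?_
  induction n with
  | zero => exact contDiff_zero.2 hdiff.continuous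
  | succ n ih =>
    push_cast
    refine contDiff_succ_iff_deriv.2 ⟨hdiff, by simp, ?_⟩
    rw [hd]
    exact (contDiff_infty.1 hM n).clm_apply ih

def Lmat (p q r : ℝ) : Matrix (Fin 4) (Fin 4) ℝ :=
  !![0, 1, 0, 0; 0, 0, 1, 0; 0, 0, 0, 1; p, 0, q, r]

noncomputable def Lop (p q r : ℝ) : EV →L[ℝ] EV :=
  LinearMap.toContinuousLinearMap (Matrix.toLin' (Lmat p q r))

lemma Lop_apply (p q r : ℝ) (x : EV) : Lop p q r x = ![x 1, x 2, x 3, p * x 0 + q * x 2 + r * x 3] := by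
  funext i
  fin_cases i <;> simp [Lop, Lmat, Matrix.mulVec, dotProduct, Fin.sum_univ_four]

lemma Lop_smooth (p q r : ℝ → ℝ) (hp : ContDiff ℝ (⊤ : ℕ∞) p) (hq : ContDiff ℝ (⊤ : ℕ∞) q)
    (hr : ContDiff ℝ (⊤ : ℕ∞) r) : ContDiff ℝ (⊤ : ℕ∞) fun t => Lop (p t) (q t) (r t) := by
  have : (fun t => Lop (p t) (q t) (r t)) = fun t => Lop 0 0 0 + p t • (Lop 1 0 0 - Lop 0 0 0)
      + q t • (Lop 0 1 0 - Lop 0 0 0) + r t • (Lop 0 0 1 - Lop 0 0 0) := by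
    funext t
    ext x i
    fin_cases i <;> simp [Lop_apply]
  rw [this]
  fun_prop

/-- jet -/
noncomputable def ejet (φ : ℝ → ℝ) (x : ℝ) : EV := ![φ x, deriv φ x, deriv^[2] φ x, deriv^[3] φ x]

noncomputable def EM (a b : ℝ → ℝ) (w : ℝ) (t : ℝ) : EV →L[ℝ] EV :=
  Lop (w ^ 2 * b t / a t) (-(deriv^[2] a t) / a t) (-(2 * deriv a t) / a t)

lemma EM_smooth (a b : ℝ → ℝ) (w : ℝ) (ha : ContDiff ℝ (⊤ : ℕ∞) a) (hb : ContDiff ℝ (⊤ : ℕ∞) b)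
    (hne : ∀ x, a x ≠ 0) : ContDiff ℝ (⊤ : ℕ∞) (EM a b w) := by
  have h1 : ContDiff ℝ (⊤ : ℕ∞) (deriv a) := (contDiff_infty_iff_deriv.1 ha).2
  have h2 : ContDiff ℝ (⊤ : ℕ∞) (deriv^[2] a) := (contDiff_infty_iff_deriv.1 h1).2
  exact Lop_smooth _ _ _ ((contDiff_const.mul hb).div ha hne) (h2.neg.div ha hne)
    ((contDiff_const.mul h1).neg.div ha hne)

lemma ejet_deriv (φ : ℝ → ℝ) (hφ : ContDiff ℝ (⊤ : ℕ∞) φ) (x : ℝ) :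
    HasDerivAt (ejet φ) ![deriv φ x, deriv^[2] φ x, deriv^[3] φ x, deriv^[4] φ x] x := by
  have h1 : ContDiff ℝ (⊤ : ℕ∞) (deriv φ) := (contDiff_infty_iff_deriv.1 hφ).2
  have h2 : ContDiff ℝ (⊤ : ℕ∞) (deriv^[2] φ) := (contDiff_infty_iff_deriv.1 h1).2
  have h3 : ContDiff ℝ (⊤ : ℕ∞) (deriv^[3] φ) := by
    rw [Function.iterate_succ_apply']; exact (contDiff_infty_iff_deriv.1 h2).2
  have hd : ∀ f : ℝ → ℝ, ContDiff ℝ (⊤ : ℕ∞) f → HasDerivAt f (deriv f x) x := fun f hf =>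
    ((contDiff_infty_iff_deriv.1 hf).1 x).hasDerivAt
  refine hasDerivAt_pi.2 fun i => ?_
  fin_cases i
  · exact hd _ hφ
  · exact hd _ h1
  · have := hd _ h2
    rw [← Function.iterate_succ_apply' deriv 2] at this
    exact this
  · have := hd _ h3
    rw [← Function.iterate_succ_apply' deriv 3] at this
    exact this

lemma ejet_ode (a b : ℝ → ℝ) (w : ℝ) (φ : ℝ → ℝ) (hφ : ContDiff ℝ (⊤ : ℕ∞) φ) (x : ℝ)
    (hne : a x ≠ 0)
    (h : a x * deriv^[4] φ x + 2 * deriv a x * deriv^[3] φ x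
      + deriv^[2] a x * deriv^[2] φ x - w ^ 2 * b x * φ x = 0) :
    HasDerivAt (ejet φ) (EM a b w x (ejet φ x)) x := by
  have h4 : deriv^[4] φ x = w ^ 2 * b x / a x * φ x + -(deriv^[2] a x) / a x * deriv^[2] φ x
      + -(2 * deriv a x) / a x * deriv^[3] φ x := by
    field_simp
    linear_combination h
  have := ejet_deriv φ hφ x
  rw [h4] at this
  rw [EM, Lop_apply]
  exact this

lemma eb_exists (a b : ℝ → ℝ) (w : ℝ) (ha : ContDiff ℝ (⊤ : ℕ∞) a) (hb : ContDiff ℝ (⊤ : ℕ∞) b)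
    (hne : ∀ x, a x ≠ 0) (t₀ : ℝ) (c : EV) :
    ∃ φ : ℝ → ℝ, ContDiff ℝ (⊤ : ℕ∞) φ ∧ ejet φ t₀ = c ∧
      ∀ x, a x * deriv^[4] φ x + 2 * deriv a x * deriv^[3] φ x
      + deriv^[2] a x * deriv^[2] φ x - w ^ 2 * b x * φ x = 0 := by
  have hM := EM_smooth a b w ha hb hne
  obtain ⟨α, h0, hα⟩ := exists_global _ hM.continuous t₀ c
  have hs := smooth_sol _ hM α hα
  have hc : ∀ i t, HasDerivAt (fun t => α t i) (EM a b w t (α t) i) t := fun i t =>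
    hasDerivAt_pi.1 (hα t) i
  have e1 : deriv (fun t => α t 0) = fun t => α t 1 := funext fun t => by
    rw [(hc 0 t).deriv, EM, Lop_apply]; rfl
  have e2 : deriv (fun t => α t 1) = fun t => α t 2 := funext fun t => by
    rw [(hc 1 t).deriv, EM, Lop_apply]; rfl
  have e3 : deriv (fun t => α t 2) = fun t => α t 3 := funext fun t => by
    rw [(hc 2 t).deriv, EM, Lop_apply]; rfl
  have e4 : deriv (fun t => α t 3) = fun t => w ^ 2 * b t / a t * α t 0
      + -(deriv^[2] a t) / a t * α t 2 + -(2 * deriv a t) / a t * α t 3 := funext fun t => by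
    rw [(hc 3 t).deriv, EM, Lop_apply]; rfl
  have d2 : deriv^[2] (fun t => α t 0) = fun t => α t 2 := by
    rw [Function.iterate_succ_apply, Function.iterate_one, e1, e2]
  have d3 : deriv^[3] (fun t => α t 0) = fun t => α t 3 := by
    rw [Function.iterate_succ_apply', d2, e3]
  have d4 := Function.iterate_succ_apply' deriv 3 (fun t => α t 0)
  rw [d3, e4] at d4
  refine ⟨fun t => α t 0, contDiff_pi.1 hs 0, ?_, fun x => ?_⟩
  · rw [← h0, ejet, d2, d3, e1]
    funext i
    fin_cases i <;> rfl
  · rw [d2, d3, d4]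
    have := hne x
    field_simp
    ring

lemma Bcancel (B : Matrix (Fin 4) (Fin 4) ℝ) (hB : B.det ≠ 0) (x y : EV)
    (h : B.mulVec x = B.mulVec y) : x = y := by
  have := congrArg (B⁻¹.mulVec) h
  simpa [Matrix.mulVec_mulVec, Matrix.nonsing_inv_mul _ (isUnit_iff_ne_zero.2 hB)] using this

lemma uniq_left (a b : ℝ → ℝ) (w : ℝ) (ha : ContDiff ℝ (⊤ : ℕ∞) a) (hb : ContDiff ℝ (⊤ : ℕ∞) b)
    (hne : ∀ x, a x ≠ 0) (φ ψ : ℝ → ℝ) (hφ : ContDiff ℝ (⊤ : ℕ∞) φ) (hψ : ContDiff ℝ (⊤ : ℕ∞) ψ)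
    (x₀ ξ : ℝ) (hx : x₀ < ξ) 
    (h1 : ∀ x ≤ ξ, a x * deriv^[4] φ x + 2 * deriv a x * deriv^[3] φ x
      + deriv^[2] a x * deriv^[2] φ x - w ^ 2 * b x * φ x = 0)
    (h2 : ∀ x ≤ ξ, a x * deriv^[4] ψ x + 2 * deriv a x * deriv^[3] ψ x
      + deriv^[2] a x * deriv^[2] ψ x - w ^ 2 * b x * ψ x = 0)
    (h : ejet φ x₀ = ejet ψ x₀) (x : ℝ) (hxξ : x ≤ ξ) : ejet φ x = ejet ψ x := by
  have hM := (EM_smooth a b w ha hb hne).continuous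
  obtain ⟨K, hK⟩ := bdd_M _ hM (min x x₀ - 1) ξ
  refine ODE_solution_unique_of_mem_Icc (v := fun t x => EM a b w t x) (s := fun _ => Set.univ)
    (K := K) (a := min x x₀ - 1) (b := ξ) (t₀ := x₀)
    (fun t ht => (lip_M _ K (hK t (Set.Ioo_subset_Icc_self ht))).lipschitzOnWith)
    ⟨by linarith [min_le_right x x₀], hx⟩
    (fun t _ => (ejet_deriv φ hφ t).continuousAt.continuousWithinAt)
    (fun t ht => ejet_ode a b w φ hφ t (hne t) (h1 t ht.2.le)) (fun _ _ => trivial)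
    (fun t _ => (ejet_deriv ψ hψ t).continuousAt.continuousWithinAt)
    (fun t ht => ejet_ode a b w ψ hψ t (hne t) (h2 t ht.2.le)) (fun _ _ => trivial) h
    ⟨by linarith [min_le_left x x₀], hxξ⟩

lemma uniq_right (a b : ℝ → ℝ) (w : ℝ) (ha : ContDiff ℝ (⊤ : ℕ∞) a) (hb : ContDiff ℝ (⊤ : ℕ∞) b)
    (hne : ∀ x, a x ≠ 0) (φ ψ : ℝ → ℝ) (hφ : ContDiff ℝ (⊤ : ℕ∞) φ) (hψ : ContDiff ℝ (⊤ : ℕ∞) ψ)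
    (ξ : ℝ)
    (h1 : ∀ x, ξ ≤ x → a x * deriv^[4] φ x + 2 * deriv a x * deriv^[3] φ x
      + deriv^[2] a x * deriv^[2] φ x - w ^ 2 * b x * φ x = 0)
    (h2 : ∀ x, ξ ≤ x → a x * deriv^[4] ψ x + 2 * deriv a x * deriv^[3] ψ x
      + deriv^[2] a x * deriv^[2] ψ x - w ^ 2 * b x * ψ x = 0)
    (h : ejet φ ξ = ejet ψ ξ) (x : ℝ) (hxξ : ξ ≤ x) : ejet φ x = ejet ψ x := by
  have hM := (EM_smooth a b w ha hb hne).continuous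
  obtain ⟨K, hK⟩ := bdd_M _ hM ξ x
  refine ODE_solution_unique_of_mem_Icc_right (v := fun t x => EM a b w t x)
    (s := fun _ => Set.univ) (K := K) (a := ξ) (b := x)
    (fun t ht => (lip_M _ K (hK t (Set.Ico_subset_Icc_self ht))).lipschitzOnWith)
    (fun t _ => (ejet_deriv φ hφ t).continuousAt.continuousWithinAt)
    (fun t ht => (ejet_ode a b w φ hφ t (hne t) (h1 t ht.1)).hasDerivWithinAt) (fun _ _ => trivial)
    (fun t _ => (ejet_deriv ψ hψ t).continuousAt.continuousWithinAt)
    (fun t ht => (ejet_ode a b w ψ hψ t (hne t) (h2 t ht.1)).hasDerivWithinAt) (fun _ _ => trivial)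
    h ⟨hxξ, le_rfl⟩

/-- Existence and uniqueness (on the respective half-lines) of the solution of the
boundary value problem for the Euler–Bernoulli eigenvalue equation with one singular
point `ξ₀`, provided `a₋, a₊` never vanish and `det B(ξ₀) ≠ 0`; the boundary data is
prescribed at `x₀ < ξ₀`.  Here `a0M` stands for `a₀₋`, `a1P` for `a₁₊`, etc. -/
theorem stmt_15 (a0M a0P a1M a1P b0M b0P b1M b1P : ℝ → ℝ)
    (h1 : ContDiff ℝ (⊤ : ℕ∞) a0M) (h2 : ContDiff ℝ (⊤ : ℕ∞) a0P)
    (h3 : ContDiff ℝ (⊤ : ℕ∞) a1M) (h4 : ContDiff ℝ (⊤ : ℕ∞) a1P)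
    (h5 : ContDiff ℝ (⊤ : ℕ∞) b0M) (h6 : ContDiff ℝ (⊤ : ℕ∞) b0P)
    (h7 : ContDiff ℝ (⊤ : ℕ∞) b1M) (h8 : ContDiff ℝ (⊤ : ℕ∞) b1P)
    (A₀₀ A₀₁ A₁₀ A₁₁ B₀₀ B₀₁ B₀₂ B₀₃ B₁₀ B₁₁ B₁₂ B₁₃ w ξ₀ : ℝ)
    (a aM aP bM bP : ℝ → ℝ)
    (hadef : a = a0M + a1P) (haM : aM = a0M + a1M) (haP : aP = a0P + a1P)
    (hbM : bM = b0M + b1M) (hbP : bP = b0P + b1P)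
    (hneM : ∀ x : ℝ, aM x ≠ 0) (hneP : ∀ x : ℝ, aP x ≠ 0)
    (Amat Bmat : Matrix (Fin 4) (Fin 4) ℝ)
    (hAmat : Amat =
      !![B₁₀ * w ^ 2, -(B₁₁ * w ^ 2), deriv aM ξ₀ + B₁₂ * w ^ 2, aM ξ₀ - B₁₃ * w ^ 2;
         B₁₁ * w ^ 2, -(2 * B₁₂ * w ^ 2), aM ξ₀ + 3 * B₁₃ * w ^ 2, 0;
         -(deriv a ξ₀) + B₁₂ * w ^ 2, a ξ₀ - 3 * B₁₃ * w ^ 2, -A₁₀, A₁₁;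
         a ξ₀ + B₁₃ * w ^ 2, 0, -A₁₁, 0])
    (hBmat : Bmat =
      !![-(B₀₀ * w ^ 2), B₀₁ * w ^ 2, deriv aP ξ₀ - B₀₂ * w ^ 2, aP ξ₀ + B₀₃ * w ^ 2;
         -(B₀₁ * w ^ 2), 2 * B₀₂ * w ^ 2, aP ξ₀ - 3 * B₀₃ * w ^ 2, 0;
         -(deriv a ξ₀) - B₀₂ * w ^ 2, a ξ₀ + B₀₃ * w ^ 2, A₀₀, -A₀₁;
         a ξ₀ - B₀₃ * w ^ 2, 0, A₀₁, 0])
    (hdet : Bmat.det ≠ 0) :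
    ∀ x₀ : ℝ, x₀ < ξ₀ → ∀ C₀ C₁ C₂ C₃ : ℝ,
      (∃ φ₁ φ₂ : ℝ → ℝ, EBPair aM aP bM bP Amat Bmat w ξ₀ x₀ C₀ C₁ C₂ C₃ φ₁ φ₂) ∧
      (∀ φ₁ φ₂ ψ₁ ψ₂ : ℝ → ℝ,
        EBPair aM aP bM bP Amat Bmat w ξ₀ x₀ C₀ C₁ C₂ C₃ φ₁ φ₂ →
        EBPair aM aP bM bP Amat Bmat w ξ₀ x₀ C₀ C₁ C₂ C₃ ψ₁ ψ₂ →
        (∀ x : ℝ, x ≤ ξ₀ → φ₁ x = ψ₁ x) ∧ (∀ x : ℝ, ξ₀ ≤ x → φ₂ x = ψ₂ x)) := by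
  intro x₀ hx₀ C₀ C₁ C₂ C₃
  have saM : ContDiff ℝ (⊤ : ℕ∞) aM := haM ▸ h1.add h3
  have saP : ContDiff ℝ (⊤ : ℕ∞) aP := haP ▸ h2.add h4
  have sbM : ContDiff ℝ (⊤ : ℕ∞) bM := hbM ▸ h5.add h7
  have sbP : ContDiff ℝ (⊤ : ℕ∞) bP := hbP ▸ h6.add h8
  constructor
  · obtain ⟨φ, hφ, hφ0, hφe⟩ := eb_exists aM bM w saM sbM hneM x₀ ![C₀, C₁, C₂, C₃]
    obtain ⟨ψ, hψ, hψ0, hψe⟩ := eb_exists aP bP w saP sbP hneP ξ₀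
      (Bmat⁻¹.mulVec (Amat.mulVec (ejet φ ξ₀)))
    refine ⟨φ, ψ, hφ, hψ, fun x _ => hφe x, fun x _ => hψe x, ?_, congrFun hφ0 0, congrFun hφ0 1,
      congrFun hφ0 2, congrFun hφ0 3⟩
    change Amat.mulVec (ejet φ ξ₀) = Bmat.mulVec (ejet ψ ξ₀)
    rw [hψ0, Matrix.mulVec_mulVec, Matrix.mul_nonsing_inv _ (isUnit_iff_ne_zero.2 hdet),
      Matrix.one_mulVec]
  · rintro φ₁ φ₂ ψ₁ ψ₂ ⟨p1, p2, p3, p4, p5, p6, p7, p8, p9⟩ ⟨q1, q2, q3, q4, q5, q6, q7, q8, q9⟩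
    have hl := uniq_left aM bM w saM sbM hneM φ₁ ψ₁ p1 q1 x₀ ξ₀ hx₀ p3 q3
      (by rw [ejet, ejet, p6, p7, p8, p9, q6, q7, q8, q9])
    have hl' : Bmat.mulVec (ejet φ₂ ξ₀) = Bmat.mulVec (ejet ψ₂ ξ₀) := by
      refine p5.symm.trans (Eq.trans ?_ q5)
      exact congrArg _ (hl ξ₀ le_rfl)
    have hr := uniq_right aP bP w saP sbP hneP φ₂ ψ₂ p2 q2 ξ₀ p4 q4 (Bcancel _ hdet _ _ hl')
    exact ⟨fun x hx => congrFun (hl x hx) 0, fun x hx => congrFun (hr x hx) 0⟩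
end
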